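/- arXiv:1607.03046 — 2 statements merged into one kernel-verified Lean document; each statement's English description precedes it below -/
import Mathlib

section
/- Let F(n) denote the number of rooted labeled forests on [n] avoiding all three patterns 231, 132, and 213, with the convention F(0) = 1. Then F(1) = 1 and for all n ≥ 1, F(n) = ∑_{k=1}^{n} ∑_{r=1}^{k} C(n−1,k−1)·(r−1)!·F(n−k)·F(k−r). -/
/-- A rooted labeled forest on `[n]`, encoded as a parent function
`p : Fin n → Option (Fin n)` (`p v = none` means `v` is a root).
Acyclicity is expressed by the existence of a depth function strictly
decreasing from each vertex to its parent. -/
def IsForest {n : ℕ} (p : Fin n → Option (Fin n)) : Prop :=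
  ∃ d : Fin n → ℕ, ∀ v w : Fin n, p v = some w → d w < d v

/-- `StrictAnc p a b` means `a` is a strict ancestor of `b` in the forest `p`. -/
def StrictAnc {n : ℕ} (p : Fin n → Option (Fin n)) (a b : Fin n) : Prop :=
  Relation.TransGen (fun x y : Fin n => p y = some x) a b

/-- The forest `p` contains the pattern `σ` (given in one-line notation):
there is a chain of vertices along some root-to-vertex path whose labels
are order-isomorphic to `σ`. -/
def ForestContains {n : ℕ} (p : Fin n → Option (Fin n)) (σ : List ℕ) : Prop :=
  ∃ u : Fin σ.length → Fin n,
    (∀ i j : Fin σ.length, i < j → StrictAnc p (u i) (u j)) ∧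
    (∀ i j : Fin σ.length, σ.get i < σ.get j ↔ u i < u j)

/-- The forest `p` avoids the pattern `σ`. -/
def ForestAvoids {n : ℕ} (p : Fin n → Option (Fin n)) (σ : List ℕ) : Prop :=
  ¬ ForestContains p σ

/-- Number of cycles (including fixed points) in the cycle decomposition of a
permutation. -/
def permNumCycles {n : ℕ} (π : Equiv.Perm (Fin n)) : ℕ :=
  π.cycleType.card + (Finset.univ.filter fun x => π x = x).card

/-- Unsigned Stirling number of the first kind: the number of permutations of
`[n]` with exactly `k` cycles. -/
noncomputable def stirlingFirst (n k : ℕ) : ℕ :=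
  Nat.card {π : Equiv.Perm (Fin n) // permNumCycles π = k}

/-- Stirling number of the second kind: the number of partitions of `[n]`
into `k` nonempty subsets. -/
noncomputable def stirlingSecond (n k : ℕ) : ℕ :=
  Nat.card {P : Finpartition (Finset.univ : Finset (Fin n)) // P.parts.card = k}

/-- The Bell number: the number of set partitions of `[n]`. -/
noncomputable def bellNumber (n : ℕ) : ℕ :=
  Nat.card (Finpartition (Finset.univ : Finset (Fin n)))

/-- A vertex is a top-down maximum if it is larger than all of its ancestors. -/
def IsTopDownMax {n : ℕ} (p : Fin n → Option (Fin n)) (v : Fin n) : Prop :=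
  ∀ u : Fin n, StrictAnc p u v → u < v

open Finset Relation

section Avoidance

variable {n : ℕ} {p q : Fin n → Option (Fin n)}

theorem StrictAnc.ne_of_isForest (hp : IsForest p) {a b : Fin n} (h : StrictAnc p a b) :
    a ≠ b := by
  obtain ⟨d, hd⟩ := hp
  have key : d a < d b := by
    induction h with
    | single h => exact hd _ _ h
    | tail _ h ih => exact ih.trans (hd _ _ h)
  rintro rfl
  exact lt_irrefl _ key

/-- A forest in which every chain `a`, `b`, `c` of successive descendants satisfies `b < c` if
`a < b`, and `c < a` if `b < a`. These are the forests avoiding `231`, `132` and `213`, see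
`isValleyForest_iff`. -/
def IsValleyForest (p : Fin n → Option (Fin n)) : Prop :=
  IsForest p ∧ ∀ a b c : Fin n, StrictAnc p a b → StrictAnc p b c →
    (a < b → b < c) ∧ (b < a → c < a)

theorem forestContains_of_chain {x y z : ℕ} {a b c : Fin n}
    (hab : StrictAnc p a b) (hbc : StrictAnc p b c)
    (h₁ : x < y ↔ a < b) (h₂ : x < z ↔ a < c) (h₃ : y < z ↔ b < c)
    (h₄ : y < x ↔ b < a) (h₅ : z < x ↔ c < a) (h₆ : z < y ↔ c < b) :
    ForestContains p [x, y, z] := by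
  have hac : StrictAnc p a c := hab.trans hbc
  refine ⟨![a, b, c], ?_, ?_⟩
  · intro i j hij
    change Fin 3 at i j
    fin_cases i <;> fin_cases j <;> first | assumption | exact absurd hij (by simp)
  · intro i j
    change Fin 3 at i j
    fin_cases i <;> fin_cases j <;> simp [*]

theorem isValleyForest_iff :
    IsForest p ∧ ForestAvoids p [2, 3, 1] ∧ ForestAvoids p [1, 3, 2] ∧ ForestAvoids p [2, 1, 3] ↔
      IsValleyForest p := by
  refine and_congr_right fun hp => ⟨?_, ?_⟩
  · rintro ⟨h231, h132, h213⟩ a b c hab hbc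
    have n1 := hab.ne_of_isForest hp
    have n2 := hbc.ne_of_isForest hp
    have n3 := StrictAnc.ne_of_isForest hp (TransGen.trans hab hbc)
    refine ⟨fun h => ?_, fun h => ?_⟩ <;> by_contra hc
    · rcases lt_or_gt_of_ne n3 with h' | h'
      · exact h132 (forestContains_of_chain hab hbc (by omega) (by omega) (by omega) (by omega)
          (by omega) (by omega))
      · exact h231 (forestContains_of_chain hab hbc (by omega) (by omega) (by omega) (by omega)
          (by omega) (by omega))
    · exact h213 (forestContains_of_chain hab hbc (by omega) (by omega) (by omega) (by omega)
          (by omega) (by omega))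
  · intro h
    refine ⟨?_, ?_, ?_⟩ <;> rintro ⟨u, hu, hσ⟩
    all_goals
      change Fin 3 → Fin n at u
      have h01 := hu (0 : Fin 3) (1 : Fin 3) (by decide)
      have h12 := hu (1 : Fin 3) (2 : Fin 3) (by decide)
      have hh := h _ _ _ h01 h12
      have e01 := hσ (0 : Fin 3) (1 : Fin 3)
      have e02 := hσ (0 : Fin 3) (2 : Fin 3)
      have e12 := hσ (1 : Fin 3) (2 : Fin 3)
      have e10 := hσ (1 : Fin 3) (0 : Fin 3)
      have e20 := hσ (2 : Fin 3) (0 : Fin 3)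
      have e21 := hσ (2 : Fin 3) (1 : Fin 3)
      simp at e01 e02 e12 e10 e20 e21
      omega

theorem StrictAnc.mono (hqp : ∀ v w, q v = some w → p v = some w) {a b : Fin n}
    (h : StrictAnc q a b) : StrictAnc p a b := by
  induction h with
  | single h => exact .single (hqp _ _ h)
  | tail _ h ih => exact ih.tail (hqp _ _ h)

theorem IsValleyForest.mono (hp : IsValleyForest p) (hqp : ∀ v w, q v = some w → p v = some w) :
    IsValleyForest q :=
  ⟨hp.1.imp fun _ hd v w h => hd v w (hqp v w h),
    fun a b c hab hbc => hp.2 a b c (hab.mono hqp) (hbc.mono hqp)⟩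

end Avoidance

section Counting

open scoped Classical in
/-- The valley forests whose edges all lie inside `s`; vertices outside `s` are isolated. -/
noncomputable def valleyForestsOn {n : ℕ} (s : Finset (Fin n)) :
    Finset (Fin n → Option (Fin n)) :=
  {p | IsValleyForest p ∧ ∀ v w, p v = some w → v ∈ s ∧ w ∈ s}

theorem mem_valleyForestsOn {n : ℕ} {s : Finset (Fin n)} {p : Fin n → Option (Fin n)} :
    p ∈ valleyForestsOn s ↔
      IsValleyForest p ∧ ∀ v w, p v = some w → v ∈ s ∧ w ∈ s := by
  simp [valleyForestsOn]

theorem natCard_avoiding_eq (n : ℕ) :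
    Nat.card {p : Fin n → Option (Fin n) // IsForest p ∧ ForestAvoids p [2, 3, 1] ∧
      ForestAvoids p [1, 3, 2] ∧ ForestAvoids p [2, 1, 3]} =
      #(valleyForestsOn (univ : Finset (Fin n))) := by
  classical
  simp_rw [isValleyForest_iff]
  rw [Nat.card_eq_fintype_card, Fintype.card_subtype]
  simp [valleyForestsOn]

/-- Extend a parent function along an embedding, adding isolated vertices. -/
noncomputable def extendParent {k n : ℕ} (e : Fin k ↪o Fin n) (q : Fin k → Option (Fin k)) :
    Fin n → Option (Fin n) :=
  Function.extend e (fun i => (q i).map e) (fun _ => none)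

theorem extendParent_eq_some {k n : ℕ} {e : Fin k ↪o Fin n} {q : Fin k → Option (Fin k)}
    {v w : Fin n} :
    extendParent e q v = some w ↔ ∃ i j, e i = v ∧ e j = w ∧ q i = some j := by
  by_cases hv : ∃ i, e i = v
  · obtain ⟨i, rfl⟩ := hv
    rw [extendParent, e.injective.extend_apply]
    simp only [Option.map_eq_some_iff, EmbeddingLike.apply_eq_iff_eq]
    constructor
    · rintro ⟨j, h, rfl⟩
      exact ⟨i, j, rfl, rfl, h⟩
    · rintro ⟨_, j, rfl, rfl, h⟩
      exact ⟨j, h, rfl⟩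
  · rw [extendParent, Function.extend_apply' _ _ _ hv]
    simp only [reduceCtorEq, false_iff]
    rintro ⟨i, _, rfl, _⟩
    exact hv ⟨i, rfl⟩

theorem strictAnc_extendParent {k n : ℕ} {e : Fin k ↪o Fin n} {q : Fin k → Option (Fin k)}
    {a b : Fin n} (h : StrictAnc (extendParent e q) a b) :
    ∃ i j, e i = a ∧ e j = b ∧ StrictAnc q i j := by
  induction h with
  | single h =>
    obtain ⟨i, j, rfl, rfl, hij⟩ := extendParent_eq_some.1 h
    exact ⟨j, i, rfl, rfl, .single hij⟩
  | tail _ h ih =>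
    obtain ⟨i, j, rfl, hj, hij⟩ := extendParent_eq_some.1 h
    obtain ⟨i', j', rfl, hj', h'⟩ := ih
    obtain rfl := e.injective (hj'.trans hj.symm)
    exact ⟨i', i, rfl, rfl, h'.tail hij⟩

theorem isValleyForest_extendParent {k n : ℕ} {e : Fin k ↪o Fin n}
    {q : Fin k → Option (Fin k)} :
    IsValleyForest (extendParent e q) ↔ IsValleyForest q := by
  have lift : ∀ {i j}, StrictAnc q i j → StrictAnc (extendParent e q) (e i) (e j) := by
    intro i j h
    induction h with
    | single h => exact .single (extendParent_eq_some.2 ⟨_, _, rfl, rfl, h⟩)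
    | tail _ h ih => exact ih.tail (extendParent_eq_some.2 ⟨_, _, rfl, rfl, h⟩)
  constructor
  · rintro ⟨⟨d, hd⟩, h⟩
    refine ⟨⟨d ∘ e, fun v w hvw => hd _ _ (extendParent_eq_some.2 ⟨v, w, rfl, rfl, hvw⟩)⟩,
      fun a b c hab hbc => ?_⟩
    simpa using h _ _ _ (lift hab) (lift hbc)
  · rintro ⟨⟨d, hd⟩, h⟩
    refine ⟨⟨Function.extend e d 0, fun v w hvw => ?_⟩, fun a b c hab hbc => ?_⟩
    · obtain ⟨i, j, rfl, rfl, hij⟩ := extendParent_eq_some.1 hvw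
      rw [e.injective.extend_apply, e.injective.extend_apply]
      exact hd _ _ hij
    · obtain ⟨i, j, rfl, rfl, hij⟩ := strictAnc_extendParent hab
      obtain ⟨j', l, hj, rfl, hjl⟩ := strictAnc_extendParent hbc
      obtain rfl := e.injective hj
      simpa using h _ _ _ hij hjl

theorem card_valleyForestsOn {n : ℕ} (s : Finset (Fin n)) :
    #(valleyForestsOn s) = #(valleyForestsOn (univ : Finset (Fin #s))) := by
  classical
  set e := s.orderEmbOfFin rfl with he
  have hmem : ∀ i, e i ∈ s := fun i => s.orderEmbOfFin_mem rfl i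
  have hsurj : ∀ v ∈ s, ∃ i, e i = v := fun v hv => by
    have : v ∈ Set.range e := by simpa [he] using hv
    exact this
  symm
  refine card_nbij (extendParent e) ?_ ?_ ?_
  · intro q hq
    rw [mem_coe, mem_valleyForestsOn] at hq ⊢
    refine ⟨isValleyForest_extendParent.2 hq.1, fun v w h => ?_⟩
    obtain ⟨i, j, rfl, rfl, -⟩ := extendParent_eq_some.1 h
    exact ⟨hmem i, hmem j⟩
  · intro q _ q' _ h
    funext i
    have := congrFun h (e i)
    simp only [extendParent, e.injective.extend_apply] at this
    exact Option.map_injective e.injective this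
  · intro p hp
    rw [mem_coe, mem_valleyForestsOn] at hp
    have hpre : ∃ q : Fin #s → Option (Fin #s), extendParent e q = p := by
      have : ∀ i, ∃ o : Option (Fin #s), o.map e = p (e i) := fun i => by
        cases h : p (e i) with
        | none => exact ⟨none, rfl⟩
        | some w =>
          obtain ⟨j, rfl⟩ := hsurj w (hp.2 _ _ h).2
          exact ⟨some j, rfl⟩
      choose q hq using this
      refine ⟨q, funext fun v => ?_⟩
      by_cases hv : ∃ i, e i = v
      · obtain ⟨i, rfl⟩ := hv
        rw [extendParent, e.injective.extend_apply, hq]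
      · rw [extendParent, Function.extend_apply' _ _ _ hv]
        cases h : p v with
        | none => rfl
        | some w => exact absurd (hsurj v (hp.2 _ _ h).1) hv
    obtain ⟨q, rfl⟩ := hpre
    exact ⟨q, by
      rw [mem_coe, mem_valleyForestsOn]
      exact ⟨isValleyForest_extendParent.1 hp.1, by simp⟩, rfl⟩

/-- The parent functions of increasing trees on `s` with root `r = min s`. -/
def increasingTrees {n : ℕ} (s : Finset (Fin n)) (r : Fin n) :
    Finset (Fin n → Option (Fin n)) :=
  Fintype.piFinset fun v =>
    if v ∈ s.erase r then {w ∈ s | w < v}.map .some else {none}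

theorem prod_card_filter_lt {α : Type*} [LinearOrder α] (s : Finset α) :
    ∏ v ∈ s, (#{w ∈ s | w < v} + 1) = (#s).factorial := by
  induction s using Finset.induction_on_max with
  | empty => simp
  | insert a s ha ih =>
    have has : a ∉ s := fun h => lt_irrefl _ (ha a h)
    rw [prod_insert has, card_insert_of_notMem has, Nat.factorial_succ, ← ih]
    congr 1
    · rw [filter_insert, if_neg (lt_irrefl a), filter_true_of_mem ha]
    · refine prod_congr rfl fun v hv => ?_
      rw [filter_insert, if_neg (ha v hv).not_gt]

theorem card_increasingTrees {n : ℕ} {s : Finset (Fin n)} {r : Fin n} (hr : r ∈ s)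
    (hmin : ∀ v ∈ s, r ≤ v) : #(increasingTrees s r) = (#s - 1).factorial := by
  rw [increasingTrees, Fintype.card_piFinset, ← card_erase_of_mem hr, ← prod_card_filter_lt]
  have (v : Fin n) : #(if v ∈ s.erase r then {w ∈ s | w < v}.map .some else {none}) =
      if v ∈ s.erase r then #{w ∈ s.erase r | w < v} + 1 else 1 := by
    split_ifs with hv
    · have hv' := mem_erase.1 hv
      rw [card_map, ← card_erase_add_one (a := r), filter_erase]
      exact mem_filter.2 ⟨hr, (hmin v hv'.2).lt_of_ne' hv'.1⟩
    · simp
  simp_rw [this]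
  rw [prod_ite_mem, univ_inter]

theorem mem_increasingTrees {n : ℕ} {s : Finset (Fin n)} {r : Fin n}
    {q : Fin n → Option (Fin n)} :
    q ∈ increasingTrees s r ↔ (∀ v ∈ s, v ≠ r → ∃ w ∈ s, w < v ∧ q v = some w) ∧
      ∀ v, (v ∈ s → v = r) → q v = none := by
  simp only [increasingTrees, Fintype.mem_piFinset]
  constructor
  · intro h
    refine ⟨fun v hv hvr => ?_, fun v hv => ?_⟩
    · have := h v
      rw [if_pos (mem_erase.2 ⟨hvr, hv⟩)] at this
      simp only [mem_map, mem_filter, Function.Embedding.some_apply] at this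
      obtain ⟨w, hw, e⟩ := this
      exact ⟨w, hw.1, hw.2, e.symm⟩
    · have := h v
      rwa [if_neg (by rw [mem_erase]; tauto), mem_singleton] at this
  · rintro ⟨h₁, h₂⟩ v
    split_ifs with hv
    · obtain ⟨w, hw, hwv, e⟩ := h₁ v (mem_of_mem_erase hv) (ne_of_mem_erase hv)
      simp [e, hw, hwv]
    · rw [mem_erase] at hv
      simp [h₂ v (by tauto)]

/-- The descendants of `r`, including `r` itself, are the elements of `s`. -/
def IsTreeAt {n : ℕ} (p : Fin n → Option (Fin n)) (s : Finset (Fin n)) (r : Fin n) : Prop :=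
  p r = none ∧ ∀ v, v ∈ s ↔ ReflTransGen (fun x y => p y = some x) r v

section Glue

variable {n : ℕ} {s : Finset (Fin n)} {r : Fin n}

/-- Assemble a forest in which the vertex `r` is the root of a tree with vertex set `s`: hang the
forest `q₂` on the vertices of `s` below `r` under the root of the tree `q₁` on the other vertices
of `s`, and use `q₃` outside of `s`. -/
def glueForests (s : Finset (Fin n)) (r : Fin n) (q₁ q₂ q₃ : Fin n → Option (Fin n)) :
    Fin n → Option (Fin n) := fun v =>
  if v ∈ s then if r ≤ v then q₁ v else some ((q₂ v).getD r) else q₃ v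

variable {q₁ q₂ q₃ : Fin n → Option (Fin n)}

theorem glueForests_eq_some (h₁ : q₁ ∈ increasingTrees {v ∈ s | r ≤ v} r)
    (h₂ : q₂ ∈ valleyForestsOn {v ∈ s | v < r}) (h₃ : q₃ ∈ valleyForestsOn sᶜ) {v w : Fin n}
    (h : glueForests s r q₁ q₂ q₃ v = some w) :
    (v ∉ s ∧ w ∉ s ∧ q₃ v = some w) ∨ (v ∈ s ∧ w ∈ s ∧ r ≤ w ∧ w < v) ∨
      (v ∈ s ∧ v < r ∧ w = r) ∨ (v ∈ s ∧ v < r ∧ w ∈ s ∧ w < r ∧ q₂ v = some w) := by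
  rw [mem_increasingTrees] at h₁
  rw [mem_valleyForestsOn] at h₂ h₃
  unfold glueForests at h
  split_ifs at h with hv hrv
  · by_cases hvr : v = r
    · rw [h₁.2 v (fun _ => hvr)] at h
      cases h
    · obtain ⟨w', hw', hlt, e⟩ := h₁.1 v (by simp [hv, hrv]) hvr
      rw [e] at h
      cases h
      simp only [mem_filter] at hw'
      exact .inr (.inl ⟨hv, hw'.1, hw'.2, hlt⟩)
  · cases e : q₂ v with
    | none =>
      rw [e] at h
      cases h
      exact .inr (.inr (.inl ⟨hv, not_le.1 hrv, rfl⟩))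
    | some x =>
      rw [e] at h
      cases h
      have := h₂.2 _ _ e
      simp only [mem_filter] at this
      exact .inr (.inr (.inr ⟨hv, not_le.1 hrv, this.2.1, this.2.2, by simp⟩))
  · have := h₃.2 _ _ h
    simp only [mem_compl] at this
    exact .inl ⟨hv, this.2, h⟩

theorem strictAnc_glueForests (hr : r ∈ s) (h₁ : q₁ ∈ increasingTrees {v ∈ s | r ≤ v} r)
    (h₂ : q₂ ∈ valleyForestsOn {v ∈ s | v < r}) (h₃ : q₃ ∈ valleyForestsOn sᶜ) {a b : Fin n}
    (h : StrictAnc (glueForests s r q₁ q₂ q₃) a b) :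
    (a ∉ s ∧ b ∉ s ∧ StrictAnc q₃ a b) ∨ (a ∈ s ∧ b ∈ s ∧ r ≤ a ∧ a < b) ∨
      (a = r ∧ b ∈ s ∧ b < r) ∨ (a ∈ s ∧ b ∈ s ∧ a < r ∧ b < r ∧ StrictAnc q₂ a b) := by
  induction h with
  | single h =>
    rcases glueForests_eq_some h₁ h₂ h₃ h with h | h | h | h
    · exact .inl ⟨h.2.1, h.1, .single h.2.2⟩
    · tauto
    · tauto
    · exact .inr (.inr (.inr ⟨h.2.2.1, h.1, h.2.2.2.1, h.2.1, .single h.2.2.2.2⟩))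
  | tail _ h ih =>
    rcases glueForests_eq_some h₁ h₂ h₃ h with h | h | h | h
    · rcases ih with ih | ih | ih | ih
      · exact .inl ⟨ih.1, h.1, ih.2.2.tail h.2.2⟩
      all_goals exact absurd ih.2.1 h.2.1
    · rcases ih with ih | ih | ih | ih
      · tauto
      · exact .inr (.inl ⟨ih.1, h.1, ih.2.2.1, ih.2.2.2.trans h.2.2.2⟩)
      all_goals omega
    · rcases ih with ih | ih | ih | ih
      · exact absurd (h.2.2 ▸ hr) ih.2.1
      all_goals omega
    · rcases ih with ih | ih | ih | ih
      · tauto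
      · omega
      · tauto
      · exact .inr (.inr (.inr ⟨ih.1, h.1, ih.2.2.1, h.2.1, ih.2.2.2.2.tail h.2.2.2.2⟩))

theorem isValleyForest_glueForests (hr : r ∈ s)
    (h₁ : q₁ ∈ increasingTrees {v ∈ s | r ≤ v} r)
    (h₂ : q₂ ∈ valleyForestsOn {v ∈ s | v < r}) (h₃ : q₃ ∈ valleyForestsOn sᶜ) :
    IsValleyForest (glueForests s r q₁ q₂ q₃) := by
  have hv₂ := (mem_valleyForestsOn.1 h₂).1
  have hv₃ := (mem_valleyForestsOn.1 h₃).1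
  refine ⟨?_, fun a b c hab hbc => ?_⟩
  · obtain ⟨d₂, hd₂⟩ := hv₂.1
    obtain ⟨d₃, hd₃⟩ := hv₃.1
    refine ⟨fun v => if v ∈ s then if r ≤ v then v else n + d₂ v else d₃ v, fun v w h => ?_⟩
    rcases glueForests_eq_some h₁ h₂ h₃ h with h | h | h | h
    · simpa [h.1, h.2.1] using hd₃ _ _ h.2.2
    · simpa [h.1, h.2.1, h.2.2.1, h.2.2.1.trans h.2.2.2.le] using h.2.2.2
    · obtain ⟨hv, hvr, rfl⟩ := h
      simp only [hr, hv, hvr.not_ge, if_true, if_false, le_refl]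
      omega
    · have := hd₂ _ _ h.2.2.2.2
      simpa [h.1, h.2.1.not_ge, h.2.2.1, h.2.2.2.1.not_ge]
  · rcases strictAnc_glueForests hr h₁ h₂ h₃ hab with hab | hab | hab | hab <;>
      rcases strictAnc_glueForests hr h₁ h₂ h₃ hbc with hbc | hbc | hbc | hbc
    any_goals tauto
    any_goals omega
    · exact hv₃.2 _ _ _ hab.2.2 hbc.2.2
    · exact absurd (hbc.1 ▸ hr) hab.2.1
    · exact hv₂.2 _ _ _ hab.2.2.2.2 hbc.2.2.2.2

theorem isTreeAt_glueForests (hr : r ∈ s)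
    (h₁ : q₁ ∈ increasingTrees {v ∈ s | r ≤ v} r)
    (h₂ : q₂ ∈ valleyForestsOn {v ∈ s | v < r}) (h₃ : q₃ ∈ valleyForestsOn sᶜ) :
    IsTreeAt (glueForests s r q₁ q₂ q₃) s r := by
  refine ⟨?_, fun v => ⟨fun hv => ?_, fun hv => ?_⟩⟩
  · simp [glueForests, hr, (mem_increasingTrees.1 h₁).2 r (fun _ => rfl)]
  · obtain ⟨d, hd⟩ := (isValleyForest_glueForests hr h₁ h₂ h₃).1
    induction hdv : d v using Nat.strong_induction_on generalizing v with
    | _ m ih =>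
      by_cases hvr : v = r
      · rw [hvr]
      obtain ⟨w, hw⟩ : ∃ w, glueForests s r q₁ q₂ q₃ v = some w := by
        unfold glueForests
        rw [if_pos hv]
        split_ifs with hrv
        · obtain ⟨w, -, -, h⟩ := (mem_increasingTrees.1 h₁).1 v (by simp [hv, hrv]) hvr
          exact ⟨w, h⟩
        · exact ⟨_, rfl⟩
      have hws : w ∈ s := by
        rcases glueForests_eq_some h₁ h₂ h₃ hw with h | h | h | h
        · tauto
        · tauto
        · exact h.2.2 ▸ hr
        · tauto
      exact (ih _ (hdv ▸ hd _ _ hw) w hws rfl).tail hw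
  · rcases reflTransGen_iff_eq_or_transGen.1 hv with rfl | hv
    · exact hr
    · rcases strictAnc_glueForests hr h₁ h₂ h₃ hv with h | h | h | h <;> tauto

end Glue

open scoped Classical in
/-- The valley forests in which the descendants of the root `r` are the elements of `s`. -/
noncomputable def valleyForestsWithTree {n : ℕ} (s : Finset (Fin n)) (r : Fin n) :
    Finset (Fin n → Option (Fin n)) :=
  {p | IsValleyForest p ∧ IsTreeAt p s r}

theorem mem_valleyForestsWithTree {n : ℕ} {s : Finset (Fin n)} {r : Fin n}
    {p : Fin n → Option (Fin n)} :
    p ∈ valleyForestsWithTree s r ↔ IsValleyForest p ∧ IsTreeAt p s r := by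
  simp [valleyForestsWithTree]

theorem IsTreeAt.mem_of_parent_mem {n : ℕ} {s : Finset (Fin n)} {r : Fin n}
    {p : Fin n → Option (Fin n)} (h : IsTreeAt p s r) {v w : Fin n} (hvw : p v = some w)
    (hw : w ∈ s) : v ∈ s :=
  (h.2 v).2 (((h.2 w).1 hw).tail hvw)

theorem IsTreeAt.exists_parent {n : ℕ} {s : Finset (Fin n)} {r : Fin n}
    {p : Fin n → Option (Fin n)} (h : IsTreeAt p s r) {v : Fin n} (hv : v ∈ s) (hvr : v ≠ r) :
    ∃ w ∈ s, p v = some w := by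
  rcases ReflTransGen.cases_tail ((h.2 v).1 hv) with h' | ⟨w, hw, hvw⟩
  · exact absurd h' hvr
  · exact ⟨w, (h.2 w).2 hw, hvw⟩

theorem IsTreeAt.strictAnc_root {n : ℕ} {s : Finset (Fin n)} {r : Fin n}
    {p : Fin n → Option (Fin n)} (h : IsTreeAt p s r) {v : Fin n} (hv : v ∈ s) (hvr : v ≠ r) :
    StrictAnc p r v :=
  (reflTransGen_iff_eq_or_transGen.1 ((h.2 v).1 hv)).resolve_left hvr

theorem IsTreeAt.parent_cases {n : ℕ} {s : Finset (Fin n)} {r : Fin n}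
    {p : Fin n → Option (Fin n)} (h : IsTreeAt p s r) (hp : IsValleyForest p) {v w : Fin n}
    (hv : v ∈ s) (hvw : p v = some w) :
    w ∈ s ∧ (r < v → r ≤ w ∧ w < v) ∧ (v < r → w ≤ r) ∧ v ≠ r := by
  have hvr : v ≠ r := by
    rintro rfl
    rw [h.1] at hvw
    cases hvw
  obtain ⟨w', hw', e⟩ := h.exists_parent hv hvr
  obtain rfl : w' = w := by simpa [e] using hvw
  by_cases hwr : w' = r
  · subst hwr
    exact ⟨hw', fun h => ⟨le_rfl, h⟩, fun _ => le_rfl, hvr⟩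
  · have := hp.2 r w' v (h.strictAnc_root hw' hwr) (.single hvw)
    exact ⟨hw', by omega, by omega, hvr⟩

theorem card_valleyForestsWithTree {n : ℕ} {s : Finset (Fin n)} {r : Fin n} (hr : r ∈ s) :
    #(valleyForestsWithTree s r) = (#{v ∈ s | r ≤ v} - 1).factorial *
      (#(valleyForestsOn {v ∈ s | v < r}) * #(valleyForestsOn sᶜ)) := by
  classical
  rw [← card_increasingTrees (s := {v ∈ s | r ≤ v}) (r := r) (by simp [hr]) (by simp),
    ← card_product, ← card_product]
  refine card_nbij'
    (fun p => (fun v => if v ∈ s ∧ r ≤ v then p v else none,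
      fun v => if v ∈ s ∧ v < r ∧ p v ≠ some r then p v else none,
      fun v => if v ∈ s then none else p v))
    (fun q => glueForests s r q.1 q.2.1 q.2.2) ?_ ?_ ?_ ?_
  · intro p hp
    obtain ⟨hp, ht⟩ := mem_valleyForestsWithTree.1 hp
    simp only [coe_product, Set.mem_prod, mem_coe, mem_increasingTrees, mem_valleyForestsOn,
      mem_filter, mem_compl]
    refine ⟨⟨?_, ?_⟩, ⟨hp.mono ?_, ?_⟩, hp.mono ?_, ?_⟩
    · rintro v ⟨hv, hrv⟩ hvr
      obtain ⟨w, hw, e⟩ := ht.exists_parent hv hvr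
      have := ht.parent_cases hp hv e
      exact ⟨w, ⟨hw, by omega⟩, by omega, by simp [hv, hrv, e]⟩
    · intro v hv
      split_ifs with h
      · rw [hv h, ht.1]
      · rfl
    · intro v w h
      split_ifs at h
      exact h
    · intro v w h
      split_ifs at h with h'
      have := ht.parent_cases hp h'.1 h
      have hwr : w ≠ r := by
        rintro rfl
        exact h'.2.2 h
      exact ⟨⟨h'.1, h'.2.1⟩, this.1, by omega⟩
    · intro v w h
      split_ifs at h
      exact h
    · intro v w h
      split_ifs at h with h'
      exact ⟨h', fun hw => h' (ht.mem_of_parent_mem h hw)⟩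
  · rintro ⟨q₁, q₂, q₃⟩ hq
    simp only [coe_product, Set.mem_prod, mem_coe] at hq
    rw [mem_coe, mem_valleyForestsWithTree]
    exact ⟨isValleyForest_glueForests hr hq.1 hq.2.1 hq.2.2,
      isTreeAt_glueForests hr hq.1 hq.2.1 hq.2.2⟩
  · intro p hp
    obtain ⟨hp, ht⟩ := mem_valleyForestsWithTree.1 hp
    funext v
    simp only [glueForests]
    by_cases hv : v ∈ s
    · by_cases hrv : r ≤ v
      · simp [hv, hrv]
      · obtain ⟨w, hw, e⟩ := ht.exists_parent hv (by omega)
        by_cases hwr : w = r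
        · simp [hv, hrv, e, hwr]
        · simp [hv, hrv, e, hwr, not_le.1 hrv]
    · simp [hv]
  · rintro ⟨q₁, q₂, q₃⟩ hq
    simp only [coe_product, Set.mem_prod, mem_coe, mem_increasingTrees, mem_valleyForestsOn,
      mem_filter, mem_compl] at hq
    obtain ⟨⟨-, h₁⟩, ⟨-, h₂⟩, -, h₃⟩ := hq
    refine Prod.ext (funext fun v => ?_) (Prod.ext (funext fun v => ?_) (funext fun v => ?_))
    · simp only [glueForests]
      by_cases h : v ∈ s ∧ r ≤ v
      · simp [h]
      · rw [if_neg h, h₁ v fun h' => absurd h' h]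
    · simp only [glueForests]
      cases e : q₂ v with
      | none =>
        by_cases hv : v ∈ s
        · by_cases hrv : r ≤ v
          · simp [hrv.not_gt]
          · simp [hv, hrv]
        · simp [hv]
      | some w =>
        have := h₂ _ _ e
        have hwr : w ≠ r := by omega
        simp [this.1.1, this.1.2, this.1.2.not_ge, hwr]
    · simp only [glueForests]
      by_cases hv : v ∈ s
      · cases e : q₃ v with
        | none => simp [hv]
        | some w => exact absurd hv (h₃ _ _ e).1
      · simp [hv]

theorem exists_isTreeAt {n : ℕ} {p : Fin n → Option (Fin n)} (hp : IsForest p) (a : Fin n) :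
    ∃ s r, a ∈ s ∧ r ∈ s ∧ IsTreeAt p s r := by
  classical
  obtain ⟨d, hd⟩ := hp
  have : ∃ r, p r = none ∧ ReflTransGen (fun x y => p y = some x) r a := by
    induction hda : d a using Nat.strong_induction_on generalizing a with
    | _ m ih =>
      cases e : p a with
      | none => exact ⟨a, e, .refl⟩
      | some w =>
        obtain ⟨r, hr, h⟩ := ih _ (hda ▸ hd _ _ e) w rfl
        exact ⟨r, hr, h.tail e⟩
  obtain ⟨r, hr, h⟩ := this
  exact ⟨({v | ReflTransGen (fun x y => p y = some x) r v} : Finset _), r, by simpa using h,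
    by simpa using ReflTransGen.refl, hr, by simp⟩

theorem IsTreeAt.unique {n : ℕ} {p : Fin n → Option (Fin n)} {s t : Finset (Fin n)}
    {a r r' : Fin n} (h : IsTreeAt p s r) (h' : IsTreeAt p t r') (ha : a ∈ s) (ha' : a ∈ t) :
    s = t ∧ r = r' := by
  have key : r = r' := by
    have h₁ := (h.2 a).1 ha
    have h₂ := (h'.2 a).1 ha'
    clear ha ha'
    induction h₁ with
    | refl =>
      rcases ReflTransGen.cases_tail h₂ with e | ⟨w, -, hw⟩
      · exact e
      · rw [h.1] at hw
        cases hw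
    | tail _ hb ih =>
      rcases ReflTransGen.cases_tail h₂ with e | ⟨w, hw, hw'⟩
      · rw [e, h'.1] at hb
        cases hb
      · rw [hw'] at hb
        cases hb
        exact ih hw
  subst key
  exact ⟨by ext v; rw [h.2, h'.2], rfl⟩

theorem card_valleyForestsOn_univ_eq_sum {n : ℕ} (a : Fin n) :
    #(valleyForestsOn (univ : Finset (Fin n))) =
      ∑ s : Finset (Fin n) with a ∈ s, ∑ r ∈ s, #(valleyForestsWithTree s r) := by
  classical
  rw [sum_sigma', ← card_biUnion]
  · congr 1
    ext p
    simp only [mem_valleyForestsOn, mem_biUnion, mem_sigma, mem_filter, mem_univ, true_and,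
      mem_valleyForestsWithTree, implies_true, and_true]
    constructor
    · intro hp
      obtain ⟨s, r, ha, hr, h⟩ := exists_isTreeAt hp.1 a
      exact ⟨⟨s, r⟩, ⟨ha, hr⟩, hp, h⟩
    · rintro ⟨_, -, hp, -⟩
      exact hp
  · rintro ⟨s, r⟩ hs ⟨t, r'⟩ ht hne
    rw [Function.onFun, disjoint_left]
    intro p hp hp'
    simp only [coe_sigma, Set.mem_sigma_iff, mem_coe, mem_filter, mem_univ, true_and] at hs ht
    obtain ⟨rfl, rfl⟩ := (mem_valleyForestsWithTree.1 hp).2.unique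
      (mem_valleyForestsWithTree.1 hp').2 hs.1 ht.1
    exact hne rfl

theorem sum_card_filter_lt {α M : Type*} [LinearOrder α] [AddCommMonoid M] (s : Finset α)
    (g : ℕ → M) :
    ∑ r ∈ s, g #{v ∈ s | v < r} = ∑ i ∈ range #s, g i := by
  induction s using Finset.induction_on_max with
  | empty => simp
  | insert a s ha ih =>
    have has : a ∉ s := fun h => lt_irrefl _ (ha a h)
    rw [sum_insert has, card_insert_of_notMem has, sum_range_succ, ← ih, add_comm]
    congr 1
    · refine sum_congr rfl fun v hv => ?_
      rw [filter_insert, if_neg (ha v hv).not_gt]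
    · rw [filter_insert, if_neg (lt_irrefl a), filter_true_of_mem ha]

theorem sum_filter_mem_apply_card {α M : Type*} [Fintype α] [DecidableEq α] [AddCommMonoid M]
    (a : α) (f : ℕ → M) :
    ∑ s : Finset α with a ∈ s, f #s =
      ∑ k ∈ range (Fintype.card α), (Fintype.card α - 1).choose k • f (k + 1) := by
  have hc : #((univ : Finset α).erase a) = Fintype.card α - 1 := by
    rw [card_erase_of_mem (mem_univ a), card_univ]
  have hpos : 0 < Fintype.card α := Fintype.card_pos_iff.2 ⟨a⟩
  have h := sum_powerset_apply_card (fun k => f (k + 1)) (x := (univ : Finset α).erase a)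
  rw [hc, Nat.sub_add_cancel hpos] at h
  rw [← h]
  refine sum_nbij' (fun s => s.erase a) (fun s => insert a s) ?_ ?_ ?_ ?_ ?_
  · intro s _
    exact mem_powerset.2 (erase_subset_erase _ (subset_univ _))
  · intro s _
    simp
  · intro s hs
    exact insert_erase (by simpa using hs)
  · intro s hs
    exact erase_insert fun h => by simpa using mem_powerset.1 hs h
  · intro s hs
    rw [card_erase_add_one (by simpa using hs)]

end Counting

theorem recurrence_forests_avoiding_231_132_213 (F : ℕ → ℕ)
    (hF : ∀ j : ℕ, F j = Nat.card {p : Fin j → Option (Fin j) //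
        IsForest p ∧ ForestAvoids p [2, 3, 1] ∧ ForestAvoids p [1, 3, 2] ∧
        ForestAvoids p [2, 1, 3]}) :
    F 1 = 1 ∧ ∀ n : ℕ, 1 ≤ n →
      F n = ∑ k ∈ Finset.Icc 1 n, ∑ r ∈ Finset.Icc 1 k,
        (n - 1).choose (k - 1) * (r - 1).factorial * F (n - k) * F (k - r) := by
  have hF' : ∀ j, F j = #(valleyForestsOn (univ : Finset (Fin j))) := fun j =>
    (hF j).trans (natCard_avoiding_eq j)
  have hF₀ : F 0 = 1 := by
    rw [hF', card_eq_one]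
    refine ⟨fun _ => none, ?_⟩
    ext p
    simp only [mem_valleyForestsOn, mem_singleton, Subsingleton.elim p fun _ => none, iff_true]
    exact ⟨⟨⟨fun _ => 0, fun v => v.elim0⟩, fun a => a.elim0⟩, fun v => v.elim0⟩
  have main : ∀ n : ℕ, 1 ≤ n →
      F n = ∑ k ∈ Finset.Icc 1 n, ∑ r ∈ Finset.Icc 1 k,
        (n - 1).choose (k - 1) * (r - 1).factorial * F (n - k) * F (k - r) := by
    intro n hn
    have hterm : ∀ s : Finset (Fin n), ∑ r ∈ s, #(valleyForestsWithTree s r) =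
        ∑ i ∈ range #s, (#s - i - 1).factorial * (F i * F (n - #s)) := by
      intro s
      rw [← sum_card_filter_lt]
      refine sum_congr rfl fun r hr => ?_
      have hle : #{v ∈ s | r ≤ v} = #s - #{v ∈ s | v < r} := by
        rw [← card_filter_add_card_filter_not (s := s) (fun v => v < r)]
        simp
      rw [card_valleyForestsWithTree hr, card_valleyForestsOn, card_valleyForestsOn sᶜ, ← hF',
        ← hF', card_compl, Fintype.card_fin, hle]
    rw [hF', card_valleyForestsOn_univ_eq_sum (⟨0, hn⟩ : Fin n), sum_congr rfl fun s _ => hterm s,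
      sum_filter_mem_apply_card _
        fun k => ∑ i ∈ range k, (k - i - 1).factorial * (F i * F (n - k)), Fintype.card_fin,
      ← Finset.Ico_add_one_right_eq_Icc, sum_Ico_eq_sum_range]
    refine sum_congr (by simp) fun k _ => ?_
    rw [← Finset.Ico_add_one_right_eq_Icc, sum_Ico_eq_sum_range, ← sum_range_reflect, smul_eq_mul,
      mul_sum, Nat.add_comm 1 k]
    refine sum_congr (by simp) fun i hi => ?_
    have hi := mem_range.1 hi
    rw [show k + 1 - (k + 1 - 1 - i) - 1 = i by omega, show k + 1 - (1 + i) = k - i by omega]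
    simp only [Nat.add_sub_cancel, Nat.add_sub_cancel_left]
    ring
  refine ⟨?_, main⟩
  rw [main 1 le_rfl]
  simp [hF₀]
end

section
/- For all n ≥ 2, the number of rooted labeled trees on [n] (forests consisting of a single tree) that have a proper descent at the root and no descents at any other vertex equals n!/2. -/
open Finset in
/-- The values a parent function may take at `v` when the root is `r`, its children are smaller
than `r`, and every other vertex is smaller than its children. -/
def parentChoices {n : ℕ} (r v : Fin n) : Finset (Option (Fin n)) :=
  if v = r then {none}
  else if v < r then (insert r (Iio v)).map Function.Embedding.some
  else ((Iio v).erase r).map Function.Embedding.some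

theorem none_mem_parentChoices {n : ℕ} {r v : Fin n} : none ∈ parentChoices r v ↔ v = r := by
  unfold parentChoices
  split_ifs <;> simp_all

theorem some_mem_parentChoices {n : ℕ} {r v w : Fin n} :
    some w ∈ parentChoices r v ↔ v ≠ r ∧ (w = r ∧ v < r ∨ w ≠ r ∧ w < v) := by
  unfold parentChoices
  split_ifs with h₁ h₂
  · simp [h₁]
  · simp only [Finset.mem_map, Function.Embedding.some_apply, Option.some.injEq, exists_eq_right,
      Finset.mem_insert, Finset.mem_Iio]
    grind
  · simp only [Finset.mem_map, Function.Embedding.some_apply, Option.some.injEq, exists_eq_right,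
      Finset.mem_erase, Finset.mem_Iio]
    grind

theorem card_parentChoices {n : ℕ} (r v : Fin n) :
    (parentChoices r v).card =
      if (v : ℕ) = r then 1 else if (v : ℕ) < r then (v : ℕ) + 1 else (v : ℕ) - 1 := by
  unfold parentChoices
  simp only [← Fin.ext_iff, Fin.val_fin_lt]
  split_ifs with h₁ h₂
  · simp
  · rw [Finset.card_map, Finset.card_insert_of_notMem (by simpa using h₂.le), Fin.card_Iio]
  · have : r < v := lt_of_le_of_ne (not_lt.mp h₂) (Ne.symm h₁)
    rw [Finset.card_map, Finset.card_erase_of_mem (by simpa using this), Fin.card_Iio]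

theorem prod_range_ite_eq_mul_factorial (m r : ℕ) (hr : r < m + 2) :
    ∏ v ∈ Finset.range (m + 2), (if v = r then 1 else if v < r then v + 1 else v - 1) =
      r * m.factorial := by
  induction m with
  | zero => interval_cases r <;> simp [Finset.prod_range_succ]
  | succ m ih =>
    rw [Finset.prod_range_succ]
    rcases Nat.lt_succ_iff_lt_or_eq.mp hr with h | rfl
    · rw [ih h, if_neg (by omega), if_neg (by omega), Nat.factorial_succ]
      simp only [show m + 1 + 1 - 1 = m + 1 from rfl]
      ring
    · rw [if_pos rfl, mul_one, ← Nat.factorial_succ, ← Finset.prod_range_add_one_eq_factorial]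
      refine Finset.prod_congr rfl fun v hv => ?_
      have := Finset.mem_range.mp hv
      rw [if_neg (by omega), if_pos (by omega)]

theorem card_piFinset_parentChoices {m : ℕ} (r : Fin (m + 2)) :
    (Fintype.piFinset (parentChoices r)).card = r * m.factorial := by
  rw [Fintype.card_piFinset, ← prod_range_ite_eq_mul_factorial m r r.isLt]
  simp only [card_parentChoices]
  exact Fin.prod_univ_eq_prod_range
    (fun v => if v = (r : ℕ) then 1 else if v < r then v + 1 else v - 1) (m + 2)

theorem mem_piFinset_parentChoices_iff {n : ℕ} (hn : 2 ≤ n) (p : Fin n → Option (Fin n)) :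
    (∃ r, p ∈ Fintype.piFinset (parentChoices r)) ↔
      IsForest p ∧ (∃! r : Fin n, p r = none) ∧
        (∀ r : Fin n, p r = none →
          (∃ c : Fin n, p c = some r) ∧ ∀ c : Fin n, p c = some r → c < r) ∧
        (∀ v : Fin n, p v ≠ none → ∀ c : Fin n, p c = some v → v < c) := by
  simp only [Fintype.mem_piFinset]
  constructor
  · rintro ⟨r, hp⟩
    have hroot : ∀ v, p v = none ↔ v = r := by
      intro v
      have hv := hp v
      constructor
      · intro h
        rwa [h, none_mem_parentChoices] at hv
      · rintro rfl
        cases h : p v with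
        | none => rfl
        | some w => rw [h, some_mem_parentChoices] at hv; exact absurd rfl hv.1
    have hpar : ∀ v w, p v = some w → v ≠ r ∧ (w = r ∧ v < r ∨ w ≠ r ∧ w < v) := by
      intro v w h
      rw [← some_mem_parentChoices, ← h]
      exact hp v
    have hex : ∀ v, v ≠ r → ∃ w, p v = some w := fun v hv =>
      Option.ne_none_iff_exists'.mp fun h => hv ((hroot v).mp h)
    refine ⟨⟨fun v => if v = r then 0 else v + 1, ?_⟩, ⟨r, (hroot r).mpr rfl,
      fun s hs => (hroot s).mp hs⟩, ?_, ?_⟩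
    · intro v w h
      obtain ⟨hv, ⟨hw, -⟩ | ⟨hw, hlt⟩⟩ := hpar v w h
      · simp [hv, hw]
      · simpa [hv, hw] using hlt
    · intro s hs
      obtain rfl := (hroot s).mp hs
      refine ⟨?_, fun c hc => by grind⟩
      by_cases h₀ : (⟨0, by omega⟩ : Fin n) = s
      · obtain ⟨w, hw⟩ := hex ⟨1, by omega⟩ (by rw [← h₀]; simp)
        have := (hpar _ _ hw).2
        simp only [← h₀, Fin.lt_def, ne_eq, Fin.ext_iff] at this
        omega
      · obtain ⟨w, hw⟩ := hex _ h₀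
        obtain ⟨-, ⟨rfl, -⟩ | ⟨-, hlt⟩⟩ := hpar _ _ hw
        · exact ⟨_, hw⟩
        · simp [Fin.lt_def] at hlt
    · intro v hv c hc
      obtain ⟨-, ⟨rfl, -⟩ | ⟨-, hlt⟩⟩ := hpar _ _ hc
      · exact absurd ((hroot v).mpr rfl) hv
      · exact hlt
  · rintro ⟨-, ⟨r, hr, huniq⟩, hdesc, hasc⟩
    refine ⟨r, fun v => ?_⟩
    cases h : p v with
    | none => exact none_mem_parentChoices.mpr (huniq v h)
    | some w =>
      refine some_mem_parentChoices.mpr ⟨fun hv => by simp_all, ?_⟩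
      by_cases hw : w = r
      · subst hw
        exact Or.inl ⟨rfl, (hdesc w hr).2 v h⟩
      · exact Or.inr ⟨hw, hasc w (fun hnone => hw (huniq w hnone)) v h⟩

theorem count_trees_proper_descent_at_root (n : ℕ) (hn : 2 ≤ n) :
    Nat.card {p : Fin n → Option (Fin n) //
        IsForest p ∧ (∃! r : Fin n, p r = none) ∧
        (∀ r : Fin n, p r = none →
          (∃ c : Fin n, p c = some r) ∧ ∀ c : Fin n, p c = some r → c < r) ∧
        (∀ v : Fin n, p v ≠ none → ∀ c : Fin n, p c = some v → v < c)} =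
    n.factorial / 2 := by
  classical
  simp only [← mem_piFinset_parentChoices_iff hn]
  obtain ⟨m, rfl⟩ := Nat.exists_eq_add_of_le' hn
  have hdisj : ((Finset.univ : Finset (Fin (m + 2))) : Set (Fin (m + 2))).PairwiseDisjoint
      fun r => Fintype.piFinset (parentChoices r) := by
    intro r _ s _ hrs
    refine Finset.disjoint_left.mpr fun p hp hq => hrs ?_
    have hpr := Fintype.mem_piFinset.mp hp r
    have hqr := Fintype.mem_piFinset.mp hq r
    cases h : p r with
    | none => rwa [h, none_mem_parentChoices] at hqr
    | some w => rw [h, some_mem_parentChoices] at hpr; exact absurd rfl hpr.1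
  have hcard := Finset.card_biUnion hdisj
  simp only [card_piFinset_parentChoices] at hcard
  rw [Nat.subtype_card (Finset.univ.biUnion fun r => Fintype.piFinset (parentChoices r))
    (by simp), hcard, ← Finset.sum_mul, Fin.sum_univ_eq_sum_range (fun i => i) (m + 2)]
  have hsum := Finset.sum_range_id_mul_two (m + 2)
  refine (Nat.div_eq_of_eq_mul_left two_pos ?_).symm
  rw [mul_right_comm, hsum, Nat.factorial_succ, Nat.factorial_succ,
    show m + 2 - 1 = m + 1 from rfl]
  ring
end
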